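/- For every finite multigraph G, the minimum over all orientations D of G of the maximum out-degree Δ(D) equals ⌈ρ(G)⌉, the ceiling of the maximum subgraph density of G. In particular, G admits an orientation with maximum out-degree ⌈ρ(G)⌉, and no orientation of G has maximum out-degree smaller than ρ(G). -/

import Mathlib

/-- The out-degree of a vertex `u` in a finite directed multigraph given by its
arc map `D : E → V × V` (each arc `e` goes from `(D e).1` to `(D e).2`). -/
def outDeg {V E : Type*} [Fintype E] [DecidableEq V] (D : E → V × V) (u : V) : ℕ :=
  (Finset.univ.filter fun e => (D e).1 = u).card

/-- The maximum out-degree of the orientation `D`. -/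
def maxOutDeg {V E : Type*} [Fintype V] [Fintype E] [DecidableEq V] (D : E → V × V) : ℕ :=
  Finset.univ.sup (outDeg D)

/-- The maximum subgraph density of a finite multigraph with edge-endpoint map
`ends : E → V × V`. -/
noncomputable def mdensity {V E : Type*} [Fintype V] [Fintype E] [DecidableEq V]
    (ends : E → V × V) : NNReal :=
  Finset.univ.powerset.sup fun S : Finset V =>
    ((Finset.univ.filter fun e => (ends e).1 ∈ S ∧ (ends e).2 ∈ S).card : NNReal) /
      (S.card : NNReal)

/-- `D` is an orientation of the multigraph with endpoints `ends` if each arc is one of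
the two possible directions of the corresponding edge. -/
def IsOrientationOf {V E : Type*} (ends : E → V × V) (D : E → V × V) : Prop :=
  ∀ e, D e = ends e ∨ D e = ((ends e).2, (ends e).1)

/-- The number of edges inside `S` is at most the maximum density times `|S|`. -/
theorem card_edges_le_mdensity_mul {V E : Type*} [Fintype V] [Fintype E] [DecidableEq V]
    (ends : E → V × V) (S : Finset V) :
    ((Finset.univ.filter fun e => (ends e).1 ∈ S ∧ (ends e).2 ∈ S).card : NNReal) ≤
      mdensity ends * (S.card : NNReal) := by
  rcases S.eq_empty_or_nonempty with rfl | hS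
  · simp
  · have hpos : (0 : NNReal) < S.card := by exact_mod_cast hS.card_pos
    rw [← div_le_iff₀ hpos]
    exact Finset.le_sup (f := fun S : Finset V =>
      ((Finset.univ.filter fun e => (ends e).1 ∈ S ∧ (ends e).2 ∈ S).card : NNReal) /
        (S.card : NNReal)) (by simp)

/-- Hakimi's criterion: if every vertex set `S` spans at most `k * |S|` edges, then there is an
orientation with all out-degrees at most `k`. -/
theorem exists_orientation_maxOutDeg_le {V E : Type*} [Fintype V] [Fintype E] [DecidableEq V]
    (ends : E → V × V) (k : ℕ)
    (hk : ∀ S : Finset V,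
      (Finset.univ.filter fun e => (ends e).1 ∈ S ∧ (ends e).2 ∈ S).card ≤ S.card * k) :
    ∃ D : E → V × V, IsOrientationOf ends D ∧ maxOutDeg D ≤ k := by
  obtain ⟨f, hf, hft⟩ := (Finset.all_card_le_biUnion_card_iff_exists_injective
    (fun e => ({(ends e).1, (ends e).2} : Finset V) ×ˢ (Finset.univ : Finset (Fin k)))).1 (by
      intro A
      let S : Finset V := A.biUnion fun e => {(ends e).1, (ends e).2}
      have hunion : A.biUnion (fun e => ({(ends e).1, (ends e).2} : Finset V) ×ˢ
          (Finset.univ : Finset (Fin k))) = S ×ˢ Finset.univ := by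
        ext x
        simp [S]
      rw [hunion, Finset.card_product, Finset.card_univ, Fintype.card_fin]
      refine (Finset.card_le_card fun e he => ?_).trans (hk S)
      simp only [Finset.mem_filter, Finset.mem_univ, true_and, S, Finset.mem_biUnion]
      exact ⟨⟨e, he, by simp⟩, ⟨e, he, by simp⟩⟩)
  let D : E → V × V := fun e =>
    if (f e).1 = (ends e).1 then ends e else ((ends e).2, (ends e).1)
  have hD : ∀ e, (D e).1 = (f e).1 := by
    intro e
    have h := hft e
    simp only [Finset.mem_product, Finset.mem_insert, Finset.mem_singleton] at h
    by_cases h1 : (f e).1 = (ends e).1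
    · simp [D, h1]
    · simpa [D, h1] using (h.1.resolve_left h1).symm
  refine ⟨D, fun e => ?_, Finset.sup_le fun u _ => ?_⟩
  · by_cases h1 : (f e).1 = (ends e).1 <;> simp [D, h1]
  · calc outDeg D u ≤ (Finset.univ : Finset (Fin k)).card := by
          refine Finset.card_le_card_of_injOn (fun e => (f e).2) (by simp) ?_
          intro a ha b hb hab
          simp only [Finset.coe_filter, Finset.mem_univ, true_and, Set.mem_ofPred_eq, hD] at ha hb
          exact hf (Prod.ext (ha.trans hb.symm) hab)
      _ = k := by simp

/-- In any orientation, the edges inside `S` leave vertices of `S`, so there are at most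
`Δ(D) * |S|` of them. -/
theorem card_edges_le_maxOutDeg_mul {V E : Type*} [Fintype V] [Fintype E] [DecidableEq V]
    {ends D : E → V × V} (hD : IsOrientationOf ends D) (S : Finset V) :
    (Finset.univ.filter fun e => (ends e).1 ∈ S ∧ (ends e).2 ∈ S).card ≤
      maxOutDeg D * S.card := by
  refine Finset.card_le_mul_card_image_of_maps_to (f := fun e => (D e).1) ?_ _ ?_
  · intro e he
    simp only [Finset.mem_filter, Finset.mem_univ, true_and] at he
    rcases hD e with h | h <;> simp [h, he.1, he.2]
  · intro u _
    refine (Finset.card_le_card ?_).trans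
      (Finset.le_sup (f := outDeg D) (Finset.mem_univ u))
    exact Finset.filter_subset_filter _ (Finset.subset_univ _)

/-- For every finite multigraph `G`, the minimum over all orientations `D` of the maximum
out-degree `Δ(D)` equals `⌈ρ(G)⌉`: there is an orientation with maximum out-degree at most
`⌈ρ(G)⌉`, and every orientation has maximum out-degree at least `ρ(G)`. -/
theorem min_maxOutDeg_eq_ceil_density
    {V E : Type*} [Fintype V] [Fintype E] [DecidableEq V]
    (ends : E → V × V) :
    (∃ D : E → V × V, IsOrientationOf ends D ∧
      maxOutDeg D ≤ ⌈(mdensity ends : ℝ)⌉₊) ∧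
    (∀ D : E → V × V, IsOrientationOf ends D →
      (mdensity ends : ℝ) ≤ (maxOutDeg D : ℝ)) := by
  refine ⟨exists_orientation_maxOutDeg_le ends _ fun S => ?_, fun D hD => ?_⟩
  · have h : ((Finset.univ.filter fun e => (ends e).1 ∈ S ∧ (ends e).2 ∈ S).card : ℝ) ≤
        mdensity ends * (S.card : ℝ) := by
      exact_mod_cast card_edges_le_mdensity_mul ends S
    have h' : (mdensity ends : ℝ) * (S.card : ℝ) ≤
        S.card * (⌈(mdensity ends : ℝ)⌉₊ : ℝ) := by
      rw [mul_comm]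
      gcongr
      exact Nat.le_ceil _
    exact_mod_cast h.trans h'
  · have h : mdensity ends ≤ (maxOutDeg D : NNReal) := by
      refine Finset.sup_le fun S _ => div_le_of_le_mul₀ (by positivity) (by positivity) ?_
      exact_mod_cast card_edges_le_maxOutDeg_mul hD S
    exact_mod_cast h
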